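/- If there exists a bounded C¹ function b : ℝ → ℝ such that b'(t) ≤ h(t, b(t)) for all t ∈ ℝ, then the set B of initial pairs giving rise to globally defined bounded solutions of x' = h(t,x) is nonempty, and r(t) ≤ b(t) ≤ a(t) for all t ∈ ℝ. If moreover b'(t) < h(t, b(t)) for all t ∈ ℝ, then r(t) < b(t) < a(t) for all t ∈ ℝ. -/

import Mathlib

open Set Filter

/-- The family of maximal solutions `t ↦ X t s x₀` of the scalar ODE `x' = h (t, x)`. -/
structure MaxSolFamily (h : ℝ → ℝ → ℝ) where
  X : ℝ → ℝ → ℝ → ℝ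
  dom : ℝ → ℝ → Set ℝ
  dom_open : ∀ s x₀, IsOpen (dom s x₀)
  dom_ordConn : ∀ s x₀, (dom s x₀).OrdConnected
  mem_dom : ∀ s x₀, s ∈ dom s x₀
  init : ∀ s x₀, X s s x₀ = x₀
  sol : ∀ s x₀, ∀ t ∈ dom s x₀, HasDerivAt (fun τ => X τ s x₀) (h t (X t s x₀)) t
  maximal : ∀ s x₀ (y : ℝ → ℝ) (I : Set ℝ), IsOpen I → I.OrdConnected → s ∈ I →
      y s = x₀ → (∀ t ∈ I, HasDerivAt y (h t (y t)) t) →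
      I ⊆ dom s x₀ ∧ ∀ t ∈ I, y t = X t s x₀

/-- `B⁻`: solutions bounded above in the past. -/
def Bminus {h : ℝ → ℝ → ℝ} (F : MaxSolFamily h) : Set (ℝ × ℝ) :=
  {sx | BddAbove ((fun t => F.X t sx.1 sx.2) '' (F.dom sx.1 sx.2 ∩ Iic sx.1))}

/-- `B⁺`: solutions bounded below in the future. -/
def Bplus {h : ℝ → ℝ → ℝ} (F : MaxSolFamily h) : Set (ℝ × ℝ) :=
  {sx | BddBelow ((fun t => F.X t sx.1 sx.2) '' (F.dom sx.1 sx.2 ∩ Ici sx.1))}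

def Rminus {h : ℝ → ℝ → ℝ} (F : MaxSolFamily h) : Set ℝ :=
  {s | ∃ x₀, (s, x₀) ∈ Bminus F}

def Rplus {h : ℝ → ℝ → ℝ} (F : MaxSolFamily h) : Set ℝ :=
  {s | ∃ x₀, (s, x₀) ∈ Bplus F}

/-- The solution `X · s x₀` is (defined and) bounded as `t → −∞`. -/
def BddAtBot {h : ℝ → ℝ → ℝ} (F : MaxSolFamily h) (s x₀ : ℝ) : Prop :=
  ∃ C : ℝ, ∀ᶠ t in atBot, t ∈ F.dom s x₀ ∧ |F.X t s x₀| ≤ C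

/-- The solution `X · s x₀` is (defined and) bounded as `t → ∞`. -/
def BddAtTop {h : ℝ → ℝ → ℝ} (F : MaxSolFamily h) (s x₀ : ℝ) : Prop :=
  ∃ C : ℝ, ∀ᶠ t in atTop, t ∈ F.dom s x₀ ∧ |F.X t s x₀| ≤ C

/-- `a` is the globally defined bounded solution characterized by:
`X · s x₀` is bounded as `t → −∞` iff `x₀ ≤ a s`. -/
def CharA {h : ℝ → ℝ → ℝ} (F : MaxSolFamily h) (a : ℝ → ℝ) : Prop :=
  (∀ t, HasDerivAt a (h t (a t)) t) ∧ (∃ C, ∀ t, |a t| ≤ C) ∧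
  ∀ s x₀ : ℝ, BddAtBot F s x₀ ↔ x₀ ≤ a s

/-- `r` is the globally defined bounded solution characterized by:
`X · s x₀` is bounded as `t → ∞` iff `x₀ ≥ r s`. -/
def CharR {h : ℝ → ℝ → ℝ} (F : MaxSolFamily h) (r : ℝ → ℝ) : Prop :=
  (∀ t, HasDerivAt r (h t (r t)) t) ∧ (∃ C, ∀ t, |r t| ≤ C) ∧
  ∀ s x₀ : ℝ, BddAtTop F s x₀ ↔ r s ≤ x₀


/-- Local Lipschitz continuity of `h` in its second argument. -/
def LocallyLipschitzSnd (h : ℝ → ℝ → ℝ) : Prop :=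
  ∀ q : ℝ × ℝ, ∃ K : ℝ, ∃ U ∈ nhds q, ∀ t x y : ℝ,
    (t, x) ∈ U → (t, y) ∈ U → |h t x - h t y| ≤ K * |x - y|

/-- The vector field governing `t ↦ -x (-t)` for solutions `x` of `x' = h (t, x)`. -/
def reflect (h : ℝ → ℝ → ℝ) : ℝ → ℝ → ℝ := fun t x => h (-t) (-x)

theorem continuous_reflect {h : ℝ → ℝ → ℝ} (hcont : Continuous fun q : ℝ × ℝ => h q.1 q.2) :
    Continuous fun q : ℝ × ℝ => reflect h q.1 q.2 :=
  hcont.comp (continuous_fst.neg.prodMk continuous_snd.neg)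

theorem LocallyLipschitzSnd.reflect {h : ℝ → ℝ → ℝ} (hlip : LocallyLipschitzSnd h) :
    LocallyLipschitzSnd (reflect h) := by
  intro q
  obtain ⟨K, U, hU, hK⟩ := hlip (-q)
  refine ⟨K, Neg.neg ⁻¹' U, continuous_neg.continuousAt.preimage_mem_nhds hU, ?_⟩
  intro t x y hx hy
  have := hK (-t) (-x) (-y) hx hy
  rwa [show -x - -y = -(x - y) by ring, abs_neg] at this

theorem hasDerivAt_neg_comp_neg {x : ℝ → ℝ} {x' t : ℝ} (hx : HasDerivAt x x' (-t)) :
    HasDerivAt (fun τ => -x (-τ)) x' t := by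
  exact (hx.comp t (hasDerivAt_neg t)).neg.congr_deriv (by simp)

/-- The reflected family of maximal solutions. -/
def MaxSolFamily.reflect {h : ℝ → ℝ → ℝ} (F : MaxSolFamily h) : MaxSolFamily (reflect h) where
  X t s x₀ := -F.X (-t) (-s) (-x₀)
  dom s x₀ := Neg.neg ⁻¹' F.dom (-s) (-x₀)
  dom_open s x₀ := (F.dom_open _ _).preimage continuous_neg
  dom_ordConn s x₀ := (F.dom_ordConn (-s) (-x₀)).preimage_anti fun _ _ => neg_le_neg
  mem_dom s x₀ := F.mem_dom _ _
  init s x₀ := by simp [F.init]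
  sol s x₀ t ht := by
    have := hasDerivAt_neg_comp_neg (F.sol (-s) (-x₀) (-t) ht)
    simpa [_root_.reflect] using this
  maximal s x₀ y I hI hIo hs hy hsol := by
    have key := F.maximal (-s) (-x₀) (fun τ => -y (-τ)) (Neg.neg ⁻¹' I)
      (hI.preimage continuous_neg) (hIo.preimage_anti fun _ _ => neg_le_neg) (by simpa using hs)
      (by simp [hy]) fun t ht => by
        have := hasDerivAt_neg_comp_neg (hsol (-t) ht)
        simpa [_root_.reflect] using this
    refine ⟨fun t ht => key.1 (by simpa using ht), fun t ht => ?_⟩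
    have := key.2 (-t) (by simpa using ht)
    simpa [neg_eq_iff_eq_neg] using this

theorem mem_Bplus_of_reflect {h : ℝ → ℝ → ℝ} {F : MaxSolFamily h} {s x₀ : ℝ}
    (hB : (-s, -x₀) ∈ Bminus F.reflect) : (s, x₀) ∈ Bplus F := by
  obtain ⟨C, hC⟩ := hB
  refine ⟨-C, ?_⟩
  rintro _ ⟨t, ⟨ht, hts⟩, rfl⟩
  have := hC ⟨-t, ⟨by simpa [MaxSolFamily.reflect] using ht, by simpa using hts⟩, rfl⟩
  simp only [MaxSolFamily.reflect, neg_neg] at this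
  exact neg_le.1 this

theorem bddAtBot_reflect {h : ℝ → ℝ → ℝ} {F : MaxSolFamily h} {s x₀ : ℝ} :
    BddAtBot F.reflect s x₀ ↔ BddAtTop F (-s) (-x₀) := by
  refine exists_congr fun C => ?_
  rw [← map_neg_atBot, eventually_map]
  simp [MaxSolFamily.reflect]

theorem CharR.reflect {h : ℝ → ℝ → ℝ} {F : MaxSolFamily h} {r : ℝ → ℝ} (hr : CharR F r) :
    CharA F.reflect fun t => -r (-t) := by
  obtain ⟨hd, ⟨C, hC⟩, hiff⟩ := hr
  refine ⟨fun t => ?_, ⟨C, fun t => by simpa using hC (-t)⟩, fun s x₀ => ?_⟩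
  · simpa [_root_.reflect] using hasDerivAt_neg_comp_neg (hd (-t))
  · rw [bddAtBot_reflect, hiff, le_neg]

/-- Strict comparison: a strict inequality between a super- and a subsolution persists forward
in time. -/
theorem LocallyLipschitzSnd.lt_of_lt {h : ℝ → ℝ → ℝ} (hlip : LocallyLipschitzSnd h)
    {u v u' v' : ℝ → ℝ} {t₀ s : ℝ} (hts : t₀ ≤ s)
    (hu : ∀ t ∈ Icc t₀ s, HasDerivAt u (u' t) t) (hv : ∀ t ∈ Icc t₀ s, HasDerivAt v (v' t) t)
    (hd : ∀ t ∈ Icc t₀ s, h t (u t) - h t (v t) ≤ u' t - v' t) (h0 : v t₀ < u t₀) :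
    v s < u s := by
  by_contra! hs
  have hderiv : ∀ t ∈ Icc t₀ s, HasDerivAt (fun τ => u τ - v τ) (u' t - v' t) t :=
    fun t ht => (hu t ht).sub (hv t ht)
  have hcont : ContinuousOn (fun τ => u τ - v τ) (Icc t₀ s) :=
    fun t ht => (hderiv t ht).continuousAt.continuousWithinAt
  have hclosed : IsCompact (Icc t₀ s ∩ (fun τ => u τ - v τ) ⁻¹' Iic 0) :=
    isCompact_Icc.of_isClosed_subset (hcont.preimage_isClosed_of_isClosed isClosed_Icc isClosed_Iic)
      inter_subset_left
  obtain ⟨t₁, ⟨ht₁, hle⟩, hleast⟩ :=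
    hclosed.exists_isLeast ⟨s, right_mem_Icc.2 hts, sub_nonpos.2 hs⟩
  have hle : u t₁ - v t₁ ≤ 0 := hle
  have hpos : ∀ t, t₀ ≤ t → t < t₁ → 0 < u t - v t := by
    intro t h1 h2
    by_contra! h3
    exact h2.not_ge (hleast ⟨⟨h1, h2.le.trans ht₁.2⟩, h3⟩)
  have ht₀₁ : t₀ < t₁ := lt_of_le_of_ne ht₁.1 (by rintro rfl; linarith)
  have heq : u t₁ = v t₁ := by
    have htend : Tendsto (fun τ => u τ - v τ) (nhdsWithin t₁ (Iio t₁)) (nhds (u t₁ - v t₁)) :=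
      (hderiv t₁ ht₁).continuousAt.tendsto.mono_left nhdsWithin_le_nhds
    have : 0 ≤ u t₁ - v t₁ := ge_of_tendsto htend <| by
      filter_upwards [Ioo_mem_nhdsLT ht₀₁] with t ht using (hpos t ht.1.le ht.2).le
    linarith
  obtain ⟨K, U, hU, hK⟩ := hlip (t₁, u t₁)
  have hUu : ∀ᶠ t in nhds t₁, (t, u t) ∈ U :=
    (continuousAt_id.prodMk (hu t₁ ht₁).continuousAt).preimage_mem_nhds hU
  have hUv : ∀ᶠ t in nhds t₁, (t, v t) ∈ U :=
    (continuousAt_id.prodMk (hv t₁ ht₁).continuousAt).preimage_mem_nhds (by simpa [← heq] using hU)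
  obtain ⟨ε, hε, hball⟩ := Metric.eventually_nhds_iff.1 (hUu.and hUv)
  obtain ⟨t₂, ht₂, ht₂₁⟩ := exists_between (max_lt ht₀₁ (sub_lt_self t₁ hε))
  have ht₀₂ : t₀ < t₂ := (le_max_left _ _).trans_lt ht₂
  have hε₂ : t₁ - ε < t₂ := (le_max_right _ _).trans_lt ht₂
  have hsub : ∀ t ∈ Icc t₂ t₁, t ∈ Icc t₀ s :=
    fun t ht => ⟨ht₀₂.le.trans ht.1, ht.2.trans ht₁.2⟩
  have hmul : ∀ t ∈ Icc t₂ t₁, HasDerivAt (fun τ => Real.exp (K * τ) * (u τ - v τ))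
      (Real.exp (K * t) * (K * (u t - v t) + (u' t - v' t))) t := by
    intro t ht
    have := (((hasDerivAt_id t).const_mul K).exp).mul (hderiv t (hsub t ht))
    refine this.congr_deriv ?_
    simp only [id]
    ring
  have hmono : MonotoneOn (fun τ => Real.exp (K * τ) * (u τ - v τ)) (Icc t₂ t₁) := by
    refine monotoneOn_of_hasDerivWithinAt_nonneg (convex_Icc _ _)
      (fun t ht => (hmul t ht).continuousAt.continuousWithinAt)
      (fun t ht => (hmul t (interior_subset ht)).hasDerivWithinAt) fun t ht => ?_
    rw [interior_Icc] at ht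
    have hdist : dist t t₁ < ε := by
      rw [Real.dist_eq, abs_lt]
      constructor <;> linarith [ht.1, ht.2]
    obtain ⟨hu', hv'⟩ := hball hdist
    have h1 := neg_le_of_abs_le (hK t (u t) (v t) hu' hv')
    rw [abs_of_pos (hpos t (ht₀₂.le.trans ht.1.le) ht.2)] at h1
    have h2 := hd t (hsub t (Ioo_subset_Icc_self ht))
    exact mul_nonneg (Real.exp_pos _).le (by linarith)
  have h1 := hmono (left_mem_Icc.2 ht₂₁.le) (right_mem_Icc.2 ht₂₁.le) ht₂₁.le
  simp only [heq, sub_self, mul_zero] at h1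
  exact h1.not_gt (mul_pos (Real.exp_pos _) (hpos t₂ ht₀₂.le ht₂₁))

/-- Two solutions that match at `T` glue to a solution near `T`. -/
theorem hasDerivAt_ite_of_tendsto {h : ℝ → ℝ → ℝ}
    (hcont : Continuous fun q : ℝ × ℝ => h q.1 q.2) {u v : ℝ → ℝ} {T σ : ℝ} (hTσ : T < σ)
    (hu : HasDerivAt u (h T (u T)) T) (hv : ∀ t ∈ Ioo T σ, HasDerivAt v (h t (v t)) t)
    (hlim : Tendsto v (nhdsWithin T (Ioi T)) (nhds (u T))) :
    HasDerivAt (fun t => if t ≤ T then u t else v t) (h T (u T)) T := by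
  set y : ℝ → ℝ := fun t => if t ≤ T then u t else v t
  have hyv : ∀ t, T < t → y t = v t := fun t ht => if_neg ht.not_ge
  have hyT : y T = u T := if_pos le_rfl
  have hyev : y =ᶠ[nhdsWithin T (Ioi T)] v := by
    filter_upwards [self_mem_nhdsWithin] with t ht using hyv t ht
  have hder : ∀ t ∈ Ioo T σ, HasDerivAt y (h t (v t)) t := fun t ht =>
    (hv t ht).congr_of_eventuallyEq <| by
      filter_upwards [Ioi_mem_nhds ht.1] with τ hτ using hyv τ hτ
  have hleft : HasDerivWithinAt y (h T (u T)) (Iic T) T :=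
    hu.hasDerivWithinAt.congr (fun t ht => if_pos ht) hyT
  have hright : HasDerivWithinAt y (h T (u T)) (Ici T) T := by
    refine hasDerivWithinAt_Ici_of_tendsto_deriv (s := Ioo T σ)
      (fun t ht => (hder t ht).differentiableAt.differentiableWithinAt) ?_
      (Ioo_mem_nhdsGT hTσ) ?_
    · rw [ContinuousWithinAt, hyT]
      exact (hlim.congr' hyev.symm).mono_left (nhdsWithin_mono _ Ioo_subset_Ioi_self)
    · have h1 : Tendsto (fun t => h t (v t)) (nhdsWithin T (Ioi T)) (nhds (h T (u T))) :=
        (hcont.tendsto (T, u T)).comp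
          ((tendsto_id.mono_left nhdsWithin_le_nhds).prodMk_nhds hlim)
      refine h1.congr' ?_
      filter_upwards [Ioo_mem_nhdsGT hTσ] with t ht using (hder t ht).deriv.symm
  have := hleft.union hright
  rwa [Iic_union_Ici, hasDerivWithinAt_univ] at this

/-- A maximal solution that stays bounded in the past is defined on the whole past. -/
theorem MaxSolFamily.Iic_subset_dom {h : ℝ → ℝ → ℝ}
    (hcont : Continuous fun q : ℝ × ℝ => h q.1 q.2) (F : MaxSolFamily h) {s x₀ C : ℝ}
    (hC : ∀ t ∈ F.dom s x₀, t ≤ s → |F.X t s x₀| ≤ C) : Iic s ⊆ F.dom s x₀ := by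
  by_contra hnot
  obtain ⟨t₀, ht₀, ht₀d⟩ := not_subset.1 hnot
  have hbdd : BddAbove (Iic s ∩ (F.dom s x₀)ᶜ) := ⟨s, fun t ht => ht.1⟩
  obtain ⟨hTs, hTd⟩ := (isClosed_Iic.inter (F.dom_open s x₀).isClosed_compl).csSup_mem
    ⟨t₀, ht₀, ht₀d⟩ hbdd
  set T := sSup (Iic s ∩ (F.dom s x₀)ᶜ)
  have hTs : T < s := lt_of_le_of_ne hTs fun he => hTd (he ▸ F.mem_dom s x₀)
  have hsub : Ioc T s ⊆ F.dom s x₀ := by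
    intro t ht
    by_contra hd
    exact ht.1.not_ge (le_csSup hbdd ⟨ht.2, hd⟩)
  obtain ⟨D, hD⟩ := (isCompact_Icc.prod (isCompact_Icc (a := -C) (b := C))).exists_bound_of_continuousOn
    (s := Icc T s ×ˢ Icc (-C) C) hcont.continuousOn
  have hLip : LipschitzOnWith D.toNNReal (fun t => F.X t s x₀) (Ioc T s) := by
    refine (convex_Ioc T s).lipschitzOnWith_of_nnnorm_hasDerivWithin_le
      (fun t ht => (F.sol s x₀ t (hsub ht)).hasDerivWithinAt) fun t ht => ?_
    refine NNReal.le_toNNReal_of_coe_le ?_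
    exact hD (t, F.X t s x₀) ⟨Ioc_subset_Icc_self ht, abs_le.1 (hC t (hsub ht) ht.2)⟩
  obtain ⟨g, hg, hgeq⟩ := hLip.extend_real
  have hlim : Tendsto (fun t => F.X t s x₀) (nhdsWithin T (Ioi T)) (nhds (g T)) := by
    refine ((hg.continuous.tendsto T).mono_left nhdsWithin_le_nhds).congr' ?_
    filter_upwards [Ioc_mem_nhdsGT hTs] with t ht using (hgeq ht).symm
  obtain ⟨ε, hε, hball⟩ := Metric.isOpen_iff.1 (F.dom_open T (g T)) T (F.mem_dom _ _)
  obtain ⟨δ, hδ, hball'⟩ := Metric.isOpen_iff.1 (F.dom_open s x₀) s (F.mem_dom _ _)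
  rw [Real.ball_eq_Ioo] at hball hball'
  have hright : ∀ t ∈ Ioo T (s + δ), t ∈ F.dom s x₀ := by
    intro t ht
    rcases le_or_gt t s with h1 | h1
    · exact hsub ⟨ht.1, h1⟩
    · exact hball' ⟨by linarith, ht.2⟩
  set y : ℝ → ℝ := fun t => if t ≤ T then F.X t T (g T) else F.X t s x₀
  have hsol : ∀ t ∈ Ioo (T - ε) (s + δ), HasDerivAt y (h t (y t)) t := by
    intro t ht
    rcases lt_trichotomy t T with h1 | h1 | h1
    · have h2 : y t = F.X t T (g T) := if_pos h1.le
      rw [h2]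
      refine (F.sol T (g T) t (hball ⟨ht.1, by linarith⟩)).congr_of_eventuallyEq ?_
      filter_upwards [Iio_mem_nhds h1] with τ hτ using if_pos hτ.le
    · subst h1
      have h2 : y T = F.X T T (g T) := if_pos le_rfl
      rw [h2]
      exact hasDerivAt_ite_of_tendsto hcont ht.2 (F.sol T (g T) T (F.mem_dom _ _))
        (fun τ hτ => F.sol s x₀ τ (hright τ hτ)) (by rwa [F.init])
    · have h2 : y t = F.X t s x₀ := if_neg h1.not_ge
      rw [h2]
      refine (F.sol s x₀ t (hright t ⟨h1, ht.2⟩)).congr_of_eventuallyEq ?_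
      filter_upwards [Ioi_mem_nhds h1] with τ hτ using if_neg (not_le.2 hτ)
  have hmax := F.maximal s x₀ y (Ioo (T - ε) (s + δ)) isOpen_Ioo ordConnected_Ioo
    ⟨by linarith, by linarith⟩ ((if_neg hTs.not_ge).trans (F.init s x₀)) hsol
  exact hTd (hmax.1 ⟨by linarith, by linarith⟩)

section Subsolution

variable {h : ℝ → ℝ → ℝ} {F : MaxSolFamily h} {b b' : ℝ → ℝ}

/-- In the past of `s`, a solution through a point of a subsolution stays below it. -/
theorem MaxSolFamily.le_subsolution (hlip : LocallyLipschitzSnd h)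
    (hbderiv : ∀ t, HasDerivAt b (b' t) t) (hineq : ∀ t, b' t ≤ h t (b t)) {s t : ℝ}
    (ht : t ∈ F.dom s (b s)) (hts : t ≤ s) : F.X t s (b s) ≤ b t := by
  by_contra! hlt
  have hsub := (F.dom_ordConn s (b s)).out ht (F.mem_dom _ _)
  have := hlip.lt_of_lt hts (fun τ hτ => F.sol s (b s) τ (hsub hτ)) (fun τ _ => hbderiv τ)
    (fun τ _ => by linarith [hineq τ]) hlt
  exact this.ne (F.init s (b s)).symm

theorem mem_Bminus_of_subsolution (hlip : LocallyLipschitzSnd h)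
    (hbderiv : ∀ t, HasDerivAt b (b' t) t) (hbbdd : ∃ C, ∀ t, |b t| ≤ C)
    (hineq : ∀ t, b' t ≤ h t (b t)) (s : ℝ) : (s, b s) ∈ Bminus F := by
  obtain ⟨C, hC⟩ := hbbdd
  refine ⟨C, ?_⟩
  rintro _ ⟨t, ⟨ht, hts⟩, rfl⟩
  exact (F.le_subsolution hlip hbderiv hineq ht hts).trans (le_of_abs_le (hC t))

/-- In the past, solutions are bounded below by any low enough constant. -/
theorem MaxSolFamily.le_of_nonpos (hlip : LocallyLipschitzSnd h) {s x₀ m t : ℝ}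
    (hm : ∀ t, h t m ≤ 0) (hmx : m ≤ x₀) (ht : t ∈ F.dom s x₀) (hts : t ≤ s) :
    m ≤ F.X t s x₀ := by
  by_contra! hlt
  have hsub := (F.dom_ordConn s x₀).out ht (F.mem_dom _ _)
  have := hlip.lt_of_lt (u := fun _ => m) hts (fun τ _ => hasDerivAt_const τ m)
    (fun τ hτ => F.sol s x₀ τ (hsub hτ)) (fun τ _ => by linarith [hm τ]) hlt
  rw [F.init] at this
  exact this.not_ge hmx

theorem bddAtBot_of_subsolution (hcont : Continuous fun q : ℝ × ℝ => h q.1 q.2)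
    (hlip : LocallyLipschitzSnd h)
    (hneg : ∃ M > (0 : ℝ), ∀ t x : ℝ, M ≤ |x| → h t x ≤ 0)
    (hbderiv : ∀ t, HasDerivAt b (b' t) t) (hbbdd : ∃ C, ∀ t, |b t| ≤ C)
    (hineq : ∀ t, b' t ≤ h t (b t)) (s : ℝ) : BddAtBot F s (b s) := by
  obtain ⟨C, hC⟩ := hbbdd
  obtain ⟨M, hM, hneg⟩ := hneg
  have hbound : ∀ t ∈ F.dom s (b s), t ≤ s → |F.X t s (b s)| ≤ max M C := by
    intro t ht hts
    refine abs_le.2 ⟨F.le_of_nonpos hlip (fun τ => hneg τ _ ?_) ?_ ht hts, ?_⟩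
    · rw [abs_neg]
      exact (le_max_left _ _).trans (le_abs_self _)
    · linarith [neg_le_of_abs_le (hC s), le_max_right M C]
    · exact (F.le_subsolution hlip hbderiv hineq ht hts).trans
        ((le_of_abs_le (hC t)).trans (le_max_right _ _))
  refine ⟨max M C, ?_⟩
  filter_upwards [eventually_le_atBot s] with t hts
  have ht := F.Iic_subset_dom hcont hbound hts
  exact ⟨ht, hbound t ht hts⟩

theorem CharA.subsolution_le (hcont : Continuous fun q : ℝ × ℝ => h q.1 q.2)
    (hlip : LocallyLipschitzSnd h)
    (hneg : ∃ M > (0 : ℝ), ∀ t x : ℝ, M ≤ |x| → h t x ≤ 0)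
    (hbderiv : ∀ t, HasDerivAt b (b' t) t) (hbbdd : ∃ C, ∀ t, |b t| ≤ C)
    (hineq : ∀ t, b' t ≤ h t (b t)) {a : ℝ → ℝ} (ha : CharA F a) (t : ℝ) : b t ≤ a t :=
  (ha.2.2 t (b t)).1 (bddAtBot_of_subsolution hcont hlip hneg hbderiv hbbdd hineq t)

theorem CharA.strict_subsolution_lt (hcont : Continuous fun q : ℝ × ℝ => h q.1 q.2)
    (hlip : LocallyLipschitzSnd h)
    (hneg : ∃ M > (0 : ℝ), ∀ t x : ℝ, M ≤ |x| → h t x ≤ 0)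
    (hbderiv : ∀ t, HasDerivAt b (b' t) t) (hbbdd : ∃ C, ∀ t, |b t| ≤ C)
    (hineq : ∀ t, b' t < h t (b t)) {a : ℝ → ℝ} (ha : CharA F a) (t : ℝ) : b t < a t := by
  have hle := ha.subsolution_le hcont hlip hneg hbderiv hbbdd fun t => (hineq t).le
  refine lt_of_le_of_ne (hle t) fun heq => ?_
  have hmin : IsLocalMin (fun τ => a τ - b τ) t := Eventually.of_forall fun τ => by
    simpa [heq] using hle τ
  have := hmin.hasDerivAt_eq_zero ((ha.1 t).sub (hbderiv t))
  rw [← heq] at this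
  linarith [hineq t]

end Subsolution

theorem stmt4 (h : ℝ → ℝ → ℝ)
    (hcont : Continuous fun q : ℝ × ℝ => h q.1 q.2)
    (hlip : ∀ q : ℝ × ℝ, ∃ K : ℝ, ∃ U ∈ nhds q, ∀ t x y : ℝ,
      (t, x) ∈ U → (t, y) ∈ U → |h t x - h t y| ≤ K * |x - y|)
    (hcoer : ∃ μ > (0:ℝ), ∃ M > (0:ℝ), ∀ t x : ℝ, M ≤ |x| → h t x ≤ -μ * x ^ 2)
    (F : MaxSolFamily h)
    (b b' : ℝ → ℝ) (hb'cont : Continuous b')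
    (hbderiv : ∀ t, HasDerivAt b (b' t) t)
    (hbbdd : ∃ C, ∀ t, |b t| ≤ C)
    (hineq : ∀ t, b' t ≤ h t (b t)) :
    (Bminus F ∩ Bplus F).Nonempty ∧
    (∀ a : ℝ → ℝ, CharA F a → ∀ t, b t ≤ a t) ∧
    (∀ r : ℝ → ℝ, CharR F r → ∀ t, r t ≤ b t) ∧
    ((∀ t, b' t < h t (b t)) →
      (∀ a : ℝ → ℝ, CharA F a → ∀ t, b t < a t) ∧
      (∀ r : ℝ → ℝ, CharR F r → ∀ t, r t < b t)) := by
  have hneg : ∃ M > (0 : ℝ), ∀ t x : ℝ, M ≤ |x| → h t x ≤ 0 := by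
    obtain ⟨μ, hμ, M, hM, hcoer⟩ := hcoer
    exact ⟨M, hM, fun t x hx => (hcoer t x hx).trans (by nlinarith [sq_nonneg x])⟩
  have hcont' := continuous_reflect hcont
  have hlip : LocallyLipschitzSnd h := hlip
  have hneg' : ∃ M > (0 : ℝ), ∀ t x : ℝ, M ≤ |x| → reflect h t x ≤ 0 := by
    obtain ⟨M, hM, hneg⟩ := hneg
    exact ⟨M, hM, fun t x hx => hneg _ _ (by rwa [abs_neg])⟩
  have hbderiv' : ∀ t, HasDerivAt (fun τ => -b (-τ)) (b' (-t)) t :=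
    fun t => hasDerivAt_neg_comp_neg (hbderiv (-t))
  have hbbdd' : ∃ C, ∀ t, |-b (-t)| ≤ C := by
    obtain ⟨C, hC⟩ := hbbdd
    exact ⟨C, fun t => by simpa using hC (-t)⟩
  have hineq' : ∀ t, b' (-t) ≤ reflect h t (-b (-t)) := fun t => by
    simpa [reflect] using hineq (-t)
  refine ⟨⟨(0, b 0), mem_Bminus_of_subsolution hlip hbderiv hbbdd hineq 0, ?_⟩,
    fun a ha => ha.subsolution_le hcont hlip hneg hbderiv hbbdd hineq, fun r hr t => ?_,
    fun hlt => ⟨fun a ha => ha.strict_subsolution_lt hcont hlip hneg hbderiv hbbdd hlt,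
      fun r hr t => ?_⟩⟩
  · apply mem_Bplus_of_reflect
    simpa using mem_Bminus_of_subsolution (F := F.reflect) hlip.reflect hbderiv' hbbdd' hineq' (-0)
  · simpa using hr.reflect.subsolution_le hcont' hlip.reflect hneg' hbderiv' hbbdd' hineq' (-t)
  · have hlt' : ∀ t, b' (-t) < reflect h t (-b (-t)) := fun t => by
      simpa [reflect] using hlt (-t)
    simpa using
      hr.reflect.strict_subsolution_lt hcont' hlip.reflect hneg' hbderiv' hbbdd' hlt' (-t)
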